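/- Let M = [[1,−1,0],[0,−1,0],[0,0,−1]] ∈ GL₃(ℤ) and let Γ be the subgroup of Aff(ℝ³) generated by the translations ℤ³ × {I₃} together with (0, M) (the crystallographic group 3/2/1/2/1). Then Spec_R(Γ) = 4ℕ ∪ {∞}, the set of positive multiples of 4 together with ∞. -/

import Mathlib

open Matrix

noncomputable section

@[ext]
structure Aff (n : ℕ) where
  tr : Fin n → ℝ
  lin : GL (Fin n) ℝ

namespace Aff

variable {n : ℕ}

instance : Mul (Aff n) :=
  ⟨fun a b => ⟨a.tr + (a.lin : Matrix (Fin n) (Fin n) ℝ) *ᵥ b.tr, a.lin * b.lin⟩⟩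

instance : One (Aff n) := ⟨⟨0, 1⟩⟩

instance : Inv (Aff n) :=
  ⟨fun a => ⟨((a.lin⁻¹ : GL (Fin n) ℝ) : Matrix (Fin n) (Fin n) ℝ) *ᵥ (-a.tr), a.lin⁻¹⟩⟩

theorem mul_def (a b : Aff n) :
    a * b = ⟨a.tr + (a.lin : Matrix (Fin n) (Fin n) ℝ) *ᵥ b.tr, a.lin * b.lin⟩ := rfl

theorem one_def : (1 : Aff n) = ⟨0, 1⟩ := rfl

theorem inv_def (a : Aff n) :
    a⁻¹ = ⟨((a.lin⁻¹ : GL (Fin n) ℝ) : Matrix (Fin n) (Fin n) ℝ) *ᵥ (-a.tr), a.lin⁻¹⟩ := rfl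

instance : Group (Aff n) where
  mul_assoc a b c := by
    ext i
    · simp [mul_def, Matrix.mulVec_add, Matrix.mulVec_mulVec, add_assoc, Units.val_mul]
    · simp [mul_def, mul_assoc]
  one_mul a := by
    ext i
    · simp [mul_def, one_def]
    · simp [mul_def, one_def]
  mul_one a := by
    ext i
    · simp [mul_def, one_def]
    · simp [mul_def, one_def]
  inv_mul_cancel a := by
    ext i
    · simp [mul_def, inv_def, one_def, Matrix.mulVec_neg]
    · simp [mul_def, inv_def, one_def]

end Aff

/-- The translation subgroup of `Γ` is exactly `ℤⁿ × {Iₙ}`. -/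
def HasIntTranslations {n : ℕ} (Γ : Subgroup (Aff n)) : Prop :=
  ∀ v : Fin n → ℝ, (Aff.mk v 1 ∈ Γ ↔ ∃ z : Fin n → ℤ, v = fun i => (z i : ℝ))

/-- The holonomy group of `Γ`, as the set of linear parts of elements of `Γ`. -/
def holonomy {n : ℕ} (Γ : Subgroup (Aff n)) : Set (GL (Fin n) ℝ) :=
  {D : GL (Fin n) ℝ | ∃ a : Fin n → ℝ, Aff.mk a D ∈ Γ}

/-- `D ∈ GLₙ(ℤ)`: both `D` and `D⁻¹` have integer entries. -/
def IsIntegralGL {n : ℕ} (D : GL (Fin n) ℝ) : Prop :=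
  (∀ i j, ∃ z : ℤ, (D : Matrix (Fin n) (Fin n) ℝ) i j = (z : ℝ)) ∧
  (∀ i j, ∃ z : ℤ, ((D⁻¹ : GL (Fin n) ℝ) : Matrix (Fin n) (Fin n) ℝ) i j = (z : ℝ))

/-- `Γ ≤ Aff(ℝⁿ)` is an `n`-dimensional crystallographic group. -/
def IsCrystallographic {n : ℕ} (Γ : Subgroup (Aff n)) : Prop :=
  HasIntTranslations Γ ∧ (holonomy Γ).Finite ∧ ∀ D ∈ holonomy Γ, IsIntegralGL D

/-- Conjugation by `g` maps `Γ` bijectively onto itself, i.e. `ξ_g` is an automorphism of `Γ`. -/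
def XiIsAut {n : ℕ} (g : Aff n) (Γ : Subgroup (Aff n)) : Prop :=
  ∀ γ : Aff n, γ ∈ Γ ↔ g * γ * g⁻¹ ∈ Γ

def twistedConj {G : Type*} [Group G] (φ : G →* G) (g g' : G) : Prop :=
  ∃ h : G, g = h * g' * (φ h)⁻¹

noncomputable def reidemeisterNumber {G : Type*} [Group G] (φ : G →* G) : ℕ∞ :=
  ENat.card (Quot (twistedConj φ))

noncomputable def reidemeisterSpectrum (G : Type*) [Group G] : Set ℕ∞ :=
  {r : ℕ∞ | ∃ φ : G ≃* G, reidemeisterNumber (φ : G →* G) = r}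

/-- The automorphism `ξ_{(d,D)}` of `Γ`, given by conjugation by `g = (d,D)`. -/
def xi {n : ℕ} (g : Aff n) (Γ : Subgroup (Aff n)) (h : XiIsAut g Γ) : Γ →* Γ where
  toFun x := ⟨g * (x : Aff n) * g⁻¹, (h x).mp x.2⟩
  map_one' := by
    apply Subtype.ext
    show g * ((1 : Γ) : Aff n) * g⁻¹ = ((1 : Γ) : Aff n)
    simp
  map_mul' x y := by
    apply Subtype.ext
    show g * ((x * y : Γ) : Aff n) * g⁻¹ =
      (g * (x : Aff n) * g⁻¹) * (g * (y : Aff n) * g⁻¹)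
    simp only [Subgroup.coe_mul]
    group

/-- `|x|_∞` for an integer `x`. -/
def intAbsInfty (x : ℤ) : ℕ∞ := if x = 0 then ⊤ else (x.natAbs : ℕ∞)

/-- `O(B,b)`: the number of solutions over `ℤ/2ℤ` of `B̄ x = b̄`. -/
noncomputable def Ocount {n : ℕ} (B : Matrix (Fin n) (Fin n) ℤ) (b : Fin n → ℤ) : ℕ :=
  Nat.card {x : Fin n → ZMod 2 // (B.map (Int.cast : ℤ → ZMod 2)) *ᵥ x = fun i => ((b i : ZMod 2))}

/-- The matrix `M = [[1,-1,0],[0,-1,0],[0,0,-1]]` over `ℝ`. -/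
def Mmat : Matrix (Fin 3) (Fin 3) ℝ := !![1,-1,0; 0,-1,0; 0,0,-1]

/-- The matrix `M = [[1,-1,0],[0,-1,0],[0,0,-1]]` over `ℤ`. -/
def MZ : Matrix (Fin 3) (Fin 3) ℤ := !![1,-1,0; 0,-1,0; 0,0,-1]

lemma Mmat_mul_self : Mmat * Mmat = 1 := by
  show (!![1,-1,0; 0,-1,0; 0,0,-1] : Matrix (Fin 3) (Fin 3) ℝ) * !![1,-1,0; 0,-1,0; 0,0,-1] = 1
  rw [Matrix.mul_fin_three, Matrix.one_fin_three]
  norm_num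

/-- `M` as an element of `GL₃(ℝ)`. -/
def MGL : GL (Fin 3) ℝ := ⟨Mmat, Mmat, Mmat_mul_self, Mmat_mul_self⟩

/-- The crystallographic group `3/2/1/2/1`, generated by the translations `ℤ³ × {I₃}`
together with `(0, M)`. -/
def Gamma3 : Subgroup (Aff 3) :=
  Subgroup.closure
    ({g : Aff 3 | ∃ z : Fin 3 → ℤ, g = Aff.mk (fun i => (z i : ℝ)) 1} ∪ {Aff.mk 0 MGL})



/-! ### A concrete model of the group -/

/-- Concrete model of the group: `(u, a, b, e)` stands for the translation
`u e₂ + a f + b e₃` (with `f = e₁ + 2 e₂`) times `M ^ e`. -/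
@[ext]
structure Gm where
  u : ℤ
  a : ℤ
  b : ℤ
  e : Bool

namespace Gm

/-- The action of `M ^ e` on the second coordinate. -/
def actA (e : Bool) (u a : ℤ) : ℤ := if e then -u - a else a

/-- The action of `M ^ e` on the third coordinate. -/
def actB (e : Bool) (b : ℤ) : ℤ := if e then -b else b

@[simp] lemma actA_true (u a : ℤ) : actA true u a = -u - a := rfl
@[simp] lemma actA_false (u a : ℤ) : actA false u a = a := rfl
@[simp] lemma actB_true (b : ℤ) : actB true b = -b := rfl
@[simp] lemma actB_false (b : ℤ) : actB false b = b := rfl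

instance : Mul Gm :=
  ⟨fun x y => ⟨x.u + y.u, x.a + actA x.e y.u y.a, x.b + actB x.e y.b, xor x.e y.e⟩⟩
instance : One Gm := ⟨⟨0, 0, 0, false⟩⟩
instance : Inv Gm := ⟨fun x => ⟨-x.u, actA x.e (-x.u) (-x.a), actB x.e (-x.b), x.e⟩⟩

lemma mul_mk (u a b : ℤ) (e : Bool) (u' a' b' : ℤ) (e' : Bool) :
    (⟨u, a, b, e⟩ * ⟨u', a', b', e'⟩ : Gm)
      = ⟨u + u', a + actA e u' a', b + actB e b', xor e e'⟩ := rfl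
lemma inv_mk (u a b : ℤ) (e : Bool) :
    (⟨u, a, b, e⟩ : Gm)⁻¹ = ⟨-u, actA e (-u) (-a), actB e (-b), e⟩ := rfl
lemma one_mk : (1 : Gm) = ⟨0, 0, 0, false⟩ := rfl

instance : Group Gm where
  mul_assoc x y z := by
    obtain ⟨u, a, b, e⟩ := x
    obtain ⟨u', a', b', e'⟩ := y
    obtain ⟨u'', a'', b'', e''⟩ := z
    cases e <;> cases e' <;> cases e'' <;> simp [mul_mk] <;> refine ⟨?_, ?_, ?_⟩ <;> ring
  one_mul x := by
    obtain ⟨u, a, b, e⟩ := x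
    cases e <;> simp [mul_mk, one_mk]
  mul_one x := by
    obtain ⟨u, a, b, e⟩ := x
    cases e <;> simp [mul_mk, one_mk]
  inv_mul_cancel x := by
    obtain ⟨u, a, b, e⟩ := x
    cases e <;> simp [mul_mk, one_mk, inv_mk]

lemma zpow_trans (u a b : ℤ) (n : ℤ) :
    (⟨u, a, b, false⟩ : Gm) ^ n = ⟨n * u, n * a, n * b, false⟩ := by
  induction n using Int.induction_on with
  | zero => simp [one_mk]
  | succ n ih => rw [_root_.zpow_add_one, ih, mul_mk]; simp; refine ⟨?_, ?_, ?_⟩ <;> ring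
  | pred n ih => rw [_root_.zpow_sub_one, ih, inv_mk, mul_mk]; simp; refine ⟨?_, ?_, ?_⟩ <;> ring

lemma MGL_mulVec (x y z : ℝ) :
    (MGL : Matrix (Fin 3) (Fin 3) ℝ) *ᵥ ![x, y, z] = ![x - y, -y, -z] := by
  have hMv : (MGL : Matrix (Fin 3) (Fin 3) ℝ) = !![1,-1,0; 0,-1,0; 0,0,-1] := rfl
  rw [hMv]
  ext i
  fin_cases i <;> simp only [Matrix.mulVec, dotProduct, Fin.sum_univ_three] <;> simp <;> ring

/-- The embedding of the model into the affine group. -/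
def toAff : Gm →* Aff 3 where
  toFun x := ⟨![(x.a : ℝ), x.u + 2 * x.a, x.b], if x.e then MGL else 1⟩
  map_one' := by
    ext i
    · fin_cases i <;> simp [one_mk, Aff.one_def]
    · simp [one_mk, Aff.one_def]
  map_mul' x y := by
    obtain ⟨u, a, b, e⟩ := x
    obtain ⟨u', a', b', e'⟩ := y
    have hM : MGL * MGL = 1 := Units.ext Mmat_mul_self
    apply Aff.ext
    · cases e <;>
      · ext i
        fin_cases i <;> simp [mul_mk, Aff.mul_def, MGL_mulVec] <;> ring
    · cases e <;> cases e' <;> simp [mul_mk, Aff.mul_def, hM]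

lemma toAff_apply (x : Gm) :
    toAff x = ⟨![(x.a : ℝ), x.u + 2 * x.a, x.b], if x.e then MGL else 1⟩ := rfl

lemma MGL_ne_one : MGL ≠ 1 := by
  intro h
  have h1 : (MGL : Matrix (Fin 3) (Fin 3) ℝ) 2 2 = (1 : Matrix (Fin 3) (Fin 3) ℝ) 2 2 := by
    rw [h]; rfl
  have h2 : (MGL : Matrix (Fin 3) (Fin 3) ℝ) 2 2 = -1 := rfl
  rw [h2] at h1
  norm_num at h1

lemma toAff_injective : Function.Injective toAff := by
  rintro ⟨u, a, b, e⟩ ⟨u', a', b', e'⟩ h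
  rw [toAff_apply, toAff_apply, Aff.mk.injEq] at h
  obtain ⟨h, hl⟩ := h
  have h0 := congrFun h 0
  have h1 := congrFun h 1
  have h2 := congrFun h 2
  simp at h0 h1 h2
  subst h0
  subst h2
  have he : e = e' := by
    cases e <;> cases e' <;> simp [MGL_ne_one, MGL_ne_one.symm] at hl ⊢
  simp at h1
  simp [h1, he]

lemma range_toAff : toAff.range = Gamma3 := by
  have key : ∀ u a b : ℤ, toAff ⟨u, a, b, false⟩ ∈ Gamma3 := by
    intro u a b
    apply Subgroup.subset_closure
    left
    refine ⟨![a, u + 2 * a, b], ?_⟩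
    ext i
    · fin_cases i <;> simp [toAff_apply]
    · simp [toAff_apply]
  have hM : toAff ⟨0, 0, 0, true⟩ = Aff.mk 0 MGL := by
    ext i
    · fin_cases i <;> simp [toAff_apply]
    · simp [toAff_apply]
  have keyM : toAff ⟨0, 0, 0, true⟩ ∈ Gamma3 := by
    apply Subgroup.subset_closure
    right
    exact hM
  apply le_antisymm
  · rintro _ ⟨⟨u, a, b, e⟩, rfl⟩
    cases e
    · exact key u a b
    · have : (⟨u, a, b, true⟩ : Gm) = ⟨u, a, b, false⟩ * ⟨0, 0, 0, true⟩ := by simp [mul_mk]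
      rw [this, map_mul]
      exact mul_mem (key u a b) keyM
  · refine (Subgroup.closure_le _).2 ?_
    rintro g (⟨z, rfl⟩ | hg)
    · refine ⟨⟨z 1 - 2 * z 0, z 0, z 2, false⟩, ?_⟩
      ext i
      · fin_cases i <;> simp [toAff_apply]
      · simp [toAff_apply]
    · rw [Set.mem_singleton_iff] at hg
      exact ⟨_, hM.trans hg.symm⟩

/-- The model is isomorphic to the crystallographic group. -/
def equivGamma : Gm ≃* Gamma3 :=
  (MonoidHom.ofInjective toAff_injective).trans (MulEquiv.subgroupCongr range_toAff)

end Gm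

lemma reidemeisterSpectrum_subset {G H : Type*} [Group G] [Group H] (e : G ≃* H) :
    reidemeisterSpectrum G ⊆ reidemeisterSpectrum H := by
  rintro r ⟨φ, rfl⟩
  refine ⟨(e.symm.trans φ).trans e, ?_⟩
  apply ENat.card_congr
  refine (Quot.congr e.toEquiv ?_).symm
  intro x y
  constructor
  · rintro ⟨h, hh⟩
    refine ⟨e h, ?_⟩
    simp [hh]
  · rintro ⟨h, hh⟩
    refine ⟨e.symm h, ?_⟩
    apply e.injective
    simpa using hh

lemma reidemeisterSpectrum_congr {G H : Type*} [Group G] [Group H] (e : G ≃* H) :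
    reidemeisterSpectrum G = reidemeisterSpectrum H :=
  Set.Subset.antisymm (reidemeisterSpectrum_subset e) (reidemeisterSpectrum_subset e.symm)

lemma twistedConj_equivalence {G : Type*} [Group G] (φ : G →* G) :
    Equivalence (twistedConj φ) where
  refl x := ⟨1, by simp⟩
  symm := by
    rintro x y ⟨h, rfl⟩
    exact ⟨h⁻¹, by simp [mul_assoc]⟩
  trans := by
    rintro x y z ⟨h, rfl⟩ ⟨k, rfl⟩
    exact ⟨h * k, by simp [mul_assoc]⟩

lemma mk_eq_iff {G : Type*} [Group G] (φ : G →* G) (x y : G) :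
    Quot.mk (twistedConj φ) x = Quot.mk (twistedConj φ) y ↔ twistedConj φ x y :=
  Equivalence.quot_mk_eq_iff (twistedConj_equivalence φ) x y

/-! ### Counting lemmas -/

lemma involution_count {X Q : Type*} [Finite X] (τ : X → X) (f : X → Q)
    (hf : Function.Surjective f) (hfx : ∀ x y, f x = f y ↔ y = x ∨ y = τ x) :
    2 * Nat.card Q = Nat.card X + Nat.card {x // τ x = x} := by
  classical
  have := Fintype.ofFinite X
  have : Finite Q := Finite.of_surjective f hf
  have := Fintype.ofFinite Q
  rw [Nat.card_eq_fintype_card, Nat.card_eq_fintype_card, Nat.card_eq_fintype_card,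
    Fintype.card_subtype]
  have h1 : Fintype.card X = ∑ q : Q, (Finset.univ.filter (fun x => f x = q)).card := by
    rw [← Finset.card_univ]
    exact Finset.card_eq_sum_card_fiberwise (fun x _ => Finset.mem_coe.2 (Finset.mem_univ _))
  have h2 : (Finset.univ.filter (fun x => τ x = x)).card
      = ∑ q : Q, ((Finset.univ.filter (fun x => τ x = x)).filter (fun x => f x = q)).card :=
    Finset.card_eq_sum_card_fiberwise (fun x _ => Finset.mem_coe.2 (Finset.mem_univ _))
  rw [h1, h2, ← Finset.sum_add_distrib]
  have h3 : ∀ q : Q, (Finset.univ.filter (fun x => f x = q)).card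
      + ((Finset.univ.filter (fun x => τ x = x)).filter (fun x => f x = q)).card = 2 := by
    intro q
    obtain ⟨x, rfl⟩ := hf q
    have hA : Finset.univ.filter (fun y => f y = f x) = {x, τ x} := by
      ext y
      simp only [Finset.mem_filter, Finset.mem_univ, true_and, Finset.mem_insert,
        Finset.mem_singleton]
      rw [eq_comm, hfx]
    have hττ : τ (τ x) = x ∨ x = τ x := by
      have : f (τ x) = f x := ((hfx _ _).2 (Or.inr rfl)).symm
      rcases (hfx _ _).1 this with h | h
      · exact Or.inr h
      · exact Or.inl h.symm
    by_cases hx : τ x = x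
    · have hB : (Finset.univ.filter (fun x => τ x = x)).filter (fun y => f y = f x) = {x} := by
        rw [Finset.filter_filter]
        ext y
        simp only [Finset.mem_filter, Finset.mem_univ, true_and, Finset.mem_singleton]
        rw [eq_comm (a := f y), hfx, hx]
        constructor
        · rintro ⟨_, h | h⟩ <;> exact h
        · rintro rfl; exact ⟨hx, Or.inl rfl⟩
      rw [hA, hB, hx]; simp
    · have hB : (Finset.univ.filter (fun x => τ x = x)).filter (fun y => f y = f x) = ∅ := by
        rw [Finset.filter_filter]
        ext y
        simp only [Finset.mem_filter, Finset.mem_univ, true_and, Finset.notMem_empty, iff_false]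
        rw [eq_comm (a := f y), hfx]
        rintro ⟨h, rfl | rfl⟩
        · exact hx h
        · rcases hττ with h' | h'
          · exact hx (h.symm.trans h')
          · exact hx h'.symm
      rw [hA, hB, Finset.card_pair (Ne.symm hx)]; simp
  rw [Finset.sum_congr rfl (fun q _ => h3 q)]
  simp [mul_comm]

lemma finite_of_involution {X Q : Type*} [Finite Q] (τ : X → X) (f : X → Q)
    (hfx : ∀ x y, f x = f y ↔ y = x ∨ y = τ x) : Finite X := by
  rw [← Set.finite_univ_iff]
  refine Set.Finite.of_finite_fibers f (Set.toFinite _) ?_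
  rintro q ⟨x, _, rfl⟩
  refine Set.Finite.subset (Set.toFinite {x, τ x}) ?_
  rintro y ⟨_, hy⟩
  exact (hfx x y).1 hy.symm

lemma card_quot_range (B : Matrix (Fin 3) (Fin 3) ℤ) (hB : B.det ≠ 0) :
    Nat.card ((Fin 3 → ℤ) ⧸ LinearMap.range B.mulVecLin) = B.det.natAbs := by
  have hinj : Function.Injective B.mulVecLin := by
    intro x y hxy
    by_contra hne
    apply hB
    rw [← Matrix.exists_mulVec_eq_zero_iff]
    refine ⟨x - y, sub_ne_zero.2 hne, ?_⟩
    have : B *ᵥ x = B *ᵥ y := hxy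
    rw [Matrix.mulVec_sub, this, sub_self]
  rw [← Submodule.natAbs_det_equiv _ (LinearEquiv.ofInjective B.mulVecLin hinj)]
  congr 1
  have : (LinearMap.range B.mulVecLin).subtype ∘ₗ
      (AddMonoidHom.toIntLinearMap (LinearEquiv.ofInjective B.mulVecLin hinj)) = B.mulVecLin := by
    ext; rfl
  rw [← LinearMap.det_toLin' B]
  rfl

lemma infinite_quot_range (B : Matrix (Fin 3) (Fin 3) ℤ) (hB : B.det = 0) :
    Infinite ((Fin 3 → ℤ) ⧸ LinearMap.range B.mulVecLin) := by
  by_contra hfin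
  rw [not_infinite_iff_finite] at hfin
  obtain ⟨v, hv, hvB⟩ := Matrix.exists_vecMul_eq_zero_iff.2 hB
  apply hv
  set n := Nat.card ((Fin 3 → ℤ) ⧸ LinearMap.range B.mulVecLin) with hn
  have hn0 : n ≠ 0 := Nat.card_pos.ne'
  ext i
  have h1 : n • (Submodule.Quotient.mk (Pi.single i 1) :
      (Fin 3 → ℤ) ⧸ LinearMap.range B.mulVecLin) = 0 := card_nsmul_eq_zero'
  rw [← Submodule.Quotient.mk_smul, Submodule.Quotient.mk_eq_zero] at h1
  obtain ⟨y, hy⟩ := h1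
  have h2 : v ⬝ᵥ (B *ᵥ y) = 0 := by rw [Matrix.dotProduct_mulVec, hvB]; simp
  have h3 : B *ᵥ y = n • Pi.single i 1 := hy
  rw [h3, dotProduct_smul] at h2
  simpa [hn0] using h2

/-! ### The quotient lattices and their involutions -/

/-- The matrix of `1 - D`. -/
def Bm (m q r s : ℤ) : Matrix (Fin 3) (Fin 3) ℤ :=
  !![2, 0, 0; -m, 2 - 2 * m, -r; -q, -2 * q, 1 - s]

/-- The matrix of `M` in the basis `e₂, f, e₃`. -/
def Mm : Matrix (Fin 3) (Fin 3) ℤ := !![1, 0, 0; -1, -1, 0; 0, 0, -1]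

/-- A lattice containing `(1 - D) ℤ³ + (M - 1) ℤ³`. -/
def Km (q : ℤ) : Matrix (Fin 3) (Fin 3) ℤ := !![2, 0, 0; 0, 1, 0; q, 0, 2]

lemma det_Bm (m q r s : ℤ) :
    (Bm m q r s).det = 2 * ((2 - 2 * m) * (1 - s) - 2 * q * r) := by
  simp [Bm, Matrix.det_fin_three]; ring

lemma det_Km (q : ℤ) : (Km q).det = 4 := by
  simp [Km, Matrix.det_fin_three]

lemma Bm_mulVec (m q r s y1 y2 y3 : ℤ) : Bm m q r s *ᵥ ![y1, y2, y3] =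
    ![2 * y1, -m * y1 + (2 - 2 * m) * y2 - r * y3, -q * y1 - 2 * q * y2 + (1 - s) * y3] := by
  ext i
  fin_cases i <;> simp only [Bm, Matrix.mulVec, dotProduct, Fin.sum_univ_three] <;> simp <;> ring

lemma Mm_mulVec (y1 y2 y3 : ℤ) : Mm *ᵥ ![y1, y2, y3] = ![y1, -y1 - y2, -y3] := by
  ext i
  fin_cases i <;> simp only [Mm, Matrix.mulVec, dotProduct, Fin.sum_univ_three] <;> simp <;> ring

lemma Km_mulVec (q y1 y2 y3 : ℤ) :
    Km q *ᵥ ![y1, y2, y3] = ![2 * y1, y2, q * y1 + 2 * y3] := by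
  ext i
  fin_cases i <;> simp only [Km, Matrix.mulVec, dotProduct, Fin.sum_univ_three] <;> simp

lemma vec_eta (x : Fin 3 → ℤ) : x = ![x 0, x 1, x 2] := by
  ext i; fin_cases i <;> rfl

/-- The image of `1 - D`. -/
def Lam (m q r s : ℤ) : Submodule ℤ (Fin 3 → ℤ) := LinearMap.range (Bm m q r s).mulVecLin

lemma mem_Lam (m q r s a b c : ℤ) : ![a, b, c] ∈ Lam m q r s ↔ ∃ y1 y2 y3 : ℤ,
    a = 2 * y1 ∧ b = -m * y1 + (2 - 2 * m) * y2 - r * y3 ∧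
    c = -q * y1 - 2 * q * y2 + (1 - s) * y3 := by
  constructor
  · rintro ⟨y, hy⟩
    rw [Matrix.mulVecLin_apply, vec_eta y, Bm_mulVec] at hy
    have h0 := congrFun hy 0
    have h1 := congrFun hy 1
    have h2 := congrFun hy 2
    exact ⟨_, _, _, h0.symm, h1.symm, h2.symm⟩
  · rintro ⟨y1, y2, y3, rfl, rfl, rfl⟩
    exact ⟨![y1, y2, y3], Bm_mulVec _ _ _ _ _ _ _⟩

lemma Lam_le (m q r s : ℤ) : Lam m q r s ≤ (Lam m q r s).comap Mm.mulVecLin := by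
  intro x hx
  rw [vec_eta x, mem_Lam] at hx
  obtain ⟨y1, y2, y3, h0, h1, h2⟩ := hx
  rw [Submodule.mem_comap, Matrix.mulVecLin_apply, vec_eta x, Mm_mulVec, mem_Lam]
  refine ⟨y1, -y1 - y2, -y3, h0, ?_, ?_⟩
  · rw [h0, h1]; ring
  · rw [h2]; ring

/-- The cokernel of `1 - D`. -/
abbrev Cq (m q r s : ℤ) : Type := (Fin 3 → ℤ) ⧸ Lam m q r s

/-- The class of a vector. -/
def cmk (m q r s a b c : ℤ) : Cq m q r s := (Lam m q r s).mkQ ![a, b, c]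

lemma cmk_surj (m q r s : ℤ) (x : Cq m q r s) : ∃ a b c, x = cmk m q r s a b c := by
  obtain ⟨v, rfl⟩ := (Lam m q r s).mkQ_surjective x
  exact ⟨v 0, v 1, v 2, by rw [cmk, ← vec_eta]⟩

lemma cmk_eq (m q r s a b c a' b' c' : ℤ) :
    cmk m q r s a b c = cmk m q r s a' b' c' ↔ ∃ y1 y2 y3 : ℤ,
    a = a' + 2 * y1 ∧ b = b' + (-m * y1 + (2 - 2 * m) * y2 - r * y3) ∧
    c = c' + (-q * y1 - 2 * q * y2 + (1 - s) * y3) := by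
  have h : ![a, b, c] - ![a', b', c'] = ![a - a', b - b', c - c'] := by simp
  rw [cmk, cmk, Submodule.mkQ_apply, Submodule.mkQ_apply, Submodule.Quotient.eq, h, mem_Lam]
  simp only [sub_eq_iff_eq_add']

/-- The map induced by `M` on the cokernel. -/
def Mbar (m q r s : ℤ) : Cq m q r s →ₗ[ℤ] Cq m q r s :=
  (Lam m q r s).mapQ _ Mm.mulVecLin (Lam_le m q r s)

lemma Mbar_cmk (m q r s a b c : ℤ) :
    Mbar m q r s (cmk m q r s a b c) = cmk m q r s a (-a - b) (-c) := by
  rw [Mbar, cmk, Submodule.mkQ_apply, Submodule.mapQ_apply, Matrix.mulVecLin_apply, Mm_mulVec]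
  rfl

/-- The affine involution on the cokernel. -/
def tau (m q r s d2 d3 : ℤ) (x : Cq m q r s) : Cq m q r s :=
  Mbar m q r s x + cmk m q r s 0 d2 d3

lemma cmk_add (m q r s a b c a' b' c' : ℤ) :
    cmk m q r s a b c + cmk m q r s a' b' c' = cmk m q r s (a + a') (b + b') (c + c') := by
  rw [cmk, cmk, cmk, ← map_add]; simp

lemma cmk_sub (m q r s a b c a' b' c' : ℤ) :
    cmk m q r s a b c - cmk m q r s a' b' c' = cmk m q r s (a - a') (b - b') (c - c') := by
  rw [cmk, cmk, cmk, ← map_sub]; simp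

lemma tau_cmk (m q r s d2 d3 a b c : ℤ) :
    tau m q r s d2 d3 (cmk m q r s a b c) = cmk m q r s a (-a - b + d2) (-c + d3) := by
  rw [tau, Mbar_cmk, cmk_add, add_zero]

lemma card_ker (m q r s : ℤ) (hs : Odd s) [Finite (Cq m q r s)] :
    Nat.card {x : Cq m q r s // Mbar m q r s x - x = 0} = 4 := by
  let ψ : Cq m q r s →+ Cq m q r s := (Mbar m q r s - LinearMap.id).toAddMonoidHom
  have hψ : ∀ x, ψ x = Mbar m q r s x - x := fun x => rfl
  have h1 : Nat.card {x : Cq m q r s // Mbar m q r s x - x = 0} = Nat.card ψ.ker := rfl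
  rw [h1, ← AddSubgroup.index_range]
  have hsurj : Function.Surjective (Lam m q r s).mkQ.toAddMonoidHom :=
    (Lam m q r s).mkQ_surjective
  rw [← AddSubgroup.index_comap_of_surjective _ hsurj]
  have hK : ψ.range.comap (Lam m q r s).mkQ.toAddMonoidHom
      = (LinearMap.range (Km q).mulVecLin).toAddSubgroup := by
    obtain ⟨t, rfl⟩ := hs
    ext x
    have hx : (Lam m q r (2 * t + 1)).mkQ x = cmk m q r (2 * t + 1) (x 0) (x 1) (x 2) := by
      rw [cmk, ← vec_eta]
    constructor
    · rintro ⟨v, hv⟩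
      obtain ⟨a, b, c, rfl⟩ := cmk_surj _ _ _ _ v
      change ψ _ = (Lam m q r (2 * t + 1)).mkQ x at hv
      rw [hx, hψ, Mbar_cmk, cmk_sub, eq_comm, cmk_eq] at hv
      obtain ⟨y1, y2, y3, h0, h1, h2⟩ := hv
      refine ⟨![y1, x 1, -c - q * y1 - q * y2 - t * y3], ?_⟩
      rw [Matrix.mulVecLin_apply, Km_mulVec]
      conv_rhs => rw [vec_eta x, h0, h2]
      congr 1
      · ring
      · congr 2; ring
    · rintro ⟨y, rfl⟩
      change (Lam m q r (2 * t + 1)).mkQ ((Km q).mulVecLin y) ∈ ψ.range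
      rw [Matrix.mulVecLin_apply, vec_eta y, Km_mulVec]
      refine ⟨cmk m q r (2 * t + 1) (-(y 1 + m * y 0)) 0 (-(q * y 0 + y 2)), ?_⟩
      rw [hψ, Mbar_cmk, cmk_sub]
      change _ = cmk m q r (2 * t + 1) (2 * y 0) (y 1) (q * y 0 + 2 * y 2)
      rw [cmk_eq]
      refine ⟨-y 0, 0, 0, ?_, ?_, ?_⟩ <;> ring
  rw [hK]
  have := card_quot_range (Km q) (by rw [det_Km]; norm_num)
  rw [det_Km] at this
  exact this

lemma card_fix (m q r s d2 d3 : ℤ) (hs : Odd s) [Finite (Cq m q r s)] :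
    Nat.card {x : Cq m q r s // tau m q r s d2 d3 x = x} = if Even d3 then 4 else 0 := by
  split_ifs with h
  · obtain ⟨k, rfl⟩ := h
    rw [← card_ker m q r s hs]
    set x0 := cmk m q r s d2 0 k with hx0
    have hfix : tau m q r s d2 (k + k) x0 = x0 := by
      rw [hx0, tau_cmk]; congr 1 <;> ring
    have hd : cmk m q r s 0 d2 (k + k) = x0 - Mbar m q r s x0 := by
      rw [tau] at hfix
      rw [eq_sub_iff_add_eq, add_comm, hfix]
    refine Nat.card_congr ((Equiv.subRight x0).subtypeEquiv ?_)
    intro x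
    rw [tau, hd, Equiv.subRight_apply, map_sub]
    constructor
    · intro h
      rw [← sub_eq_zero] at h
      rw [← h]; abel
    · intro h
      rw [← sub_eq_zero, ← h]; abel
  · rw [Nat.card_eq_zero]
    left
    constructor
    rintro ⟨x, hx⟩
    obtain ⟨a, b, c, rfl⟩ := cmk_surj _ _ _ _ x
    rw [tau_cmk, cmk_eq] at hx
    obtain ⟨y1, y2, y3, h0, h1, h2⟩ := hx
    obtain ⟨t, rfl⟩ := hs
    have : y1 = 0 := by linarith
    subst this
    apply h
    exact ⟨c - q * y2 - t * y3, by linear_combination h2⟩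

/-! ### Automorphisms of the model -/

/-- `φ` is given by an explicit matrix and an explicit translation part. -/
def HasForm (φ : Gm → Gm) (ε m q r s d2 d3 : ℤ) : Prop :=
  ∀ u a b : ℤ,
    φ ⟨u, a, b, false⟩ = ⟨ε * u, m * u + (2 * m + ε) * a + r * b,
      q * u + 2 * q * a + s * b, false⟩ ∧
    φ ⟨u, a, b, true⟩ = ⟨ε * u, m * u + (2 * m + ε) * a + r * b + d2,
      q * u + 2 * q * a + s * b + d3, true⟩

lemma trans_iff (x : Gm) : x.e = false ↔ ∀ h : Gm, x * (h * h) = (h * h) * x := by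
  obtain ⟨u, a, b, e⟩ := x
  constructor
  · rintro rfl ⟨u', a', b', e'⟩
    cases e' <;> simp [Gm.mul_mk, add_comm]
  · intro h
    have := h ⟨0, 0, 1, false⟩
    cases e
    · rfl
    · simp [Gm.mul_mk] at this
      omega

lemma aut_e (φ : Gm ≃* Gm) (x : Gm) : (φ x).e = x.e := by
  have h : (φ x).e = false ↔ x.e = false := by
    rw [trans_iff, trans_iff]
    constructor
    · intro h k
      apply φ.injective
      simpa using h (φ k)
    · intro h k
      obtain ⟨k, rfl⟩ := φ.surjective k
      simpa using congrArg φ (h k)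
  revert h
  cases (φ x).e <;> cases x.e <;> simp

lemma aut_form (φ : Gm ≃* Gm) : ∃ ε m q r s d2 d3, HasForm φ ε m q r s d2 d3 := by
  have e1 := aut_e φ ⟨1, 0, 0, false⟩
  have e2 := aut_e φ ⟨0, 1, 0, false⟩
  have e3 := aut_e φ ⟨0, 0, 1, false⟩
  have e4 := aut_e φ ⟨0, 0, 0, true⟩
  rcases h1 : φ ⟨1, 0, 0, false⟩ with ⟨ε, m, q, c1⟩
  rcases h2 : φ ⟨0, 1, 0, false⟩ with ⟨v, p, w, c2⟩
  rcases h3 : φ ⟨0, 0, 1, false⟩ with ⟨v', r, s, c3⟩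
  rcases h4 : φ ⟨0, 0, 0, true⟩ with ⟨d1, d2, d3, c4⟩
  rw [h1] at e1
  rw [h2] at e2
  rw [h3] at e3
  rw [h4] at e4
  dsimp only at e1 e2 e3 e4
  subst e1 e2 e3 e4
  have r4 : φ (⟨0, 0, 0, true⟩ * ⟨0, 0, 0, true⟩) = φ 1 := by
    congr 1
  have r1 : φ (⟨0, 0, 0, true⟩ * ⟨1, 0, 0, false⟩ * ⟨0, 1, 0, false⟩)
      = φ (⟨1, 0, 0, false⟩ * ⟨0, 0, 0, true⟩ * ⟨0, 1, 0, false⟩ * ⟨0, 1, 0, false⟩) := by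
    congr 1
  have r2 : φ (⟨0, 1, 0, false⟩ * ⟨0, 0, 0, true⟩ * ⟨0, 1, 0, false⟩) = φ ⟨0, 0, 0, true⟩ := by
    congr 1
  have r3 : φ (⟨0, 0, 1, false⟩ * ⟨0, 0, 0, true⟩ * ⟨0, 0, 1, false⟩) = φ ⟨0, 0, 0, true⟩ := by
    congr 1
  simp only [map_mul, map_one, h1, h2, h3, h4] at r1 r2 r3 r4
  simp only [Gm.mul_mk, Gm.one_mk, Gm.mk.injEq,
    Gm.actA_true, Gm.actA_false, Gm.actB_true, Gm.actB_false, Bool.xor_true, Bool.xor_false,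
    Bool.not_true, Bool.not_false] at r1 r2 r3 r4
  obtain ⟨r10, r11, r12, -⟩ := r1
  obtain ⟨r20, r21, r22, -⟩ := r2
  obtain ⟨r30, r31, r32, -⟩ := r3
  obtain ⟨r40, r41, r42, -⟩ := r4
  have hv : v = 0 := by omega
  have hv' : v' = 0 := by omega
  have hd : d1 = 0 := by omega
  have hp : p = 2 * m + ε := by omega
  have hw : w = 2 * q := by omega
  subst hv hv' hd hp hw
  have hT : ∀ u a b : ℤ, φ ⟨u, a, b, false⟩ = ⟨ε * u, m * u + (2 * m + ε) * a + r * b,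
      q * u + 2 * q * a + s * b, false⟩ := by
    intro u a b
    have hdec : (⟨u, a, b, false⟩ : Gm) =
        ⟨1, 0, 0, false⟩ ^ u * ⟨0, 1, 0, false⟩ ^ a * ⟨0, 0, 1, false⟩ ^ b := by
      simp [Gm.zpow_trans, Gm.mul_mk]
    rw [hdec, map_mul, map_mul, map_zpow, map_zpow, map_zpow, h1, h2, h3]
    simp only [Gm.zpow_trans, Gm.mul_mk, Gm.actA_false, Gm.actB_false, Gm.mk.injEq,
      Bool.xor_false, and_true]
    refine ⟨?_, ?_, ?_⟩ <;> ring
  refine ⟨ε, m, q, r, s, d2, d3, fun u a b => ⟨hT u a b, ?_⟩⟩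
  have hdec : (⟨u, a, b, true⟩ : Gm) = ⟨u, a, b, false⟩ * ⟨0, 0, 0, true⟩ := by
    simp [Gm.mul_mk]
  rw [hdec, map_mul, hT, h4]
  simp [Gm.mul_mk]

lemma form_top (φ : Gm ≃* Gm) (m q r s d2 d3 : ℤ) (h : HasForm φ 1 m q r s d2 d3) :
    reidemeisterNumber (φ : Gm →* Gm) = ⊤ := by
  have hu : ∀ x, (φ x).u = x.u := by
    rintro ⟨u, a, b, e⟩
    cases e
    · rw [(h u a b).1]; simp
    · rw [(h u a b).2]; simp
  have hmul : ∀ x y : Gm, (x * y).u = x.u + y.u := fun x y => rfl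
  have hinv : ∀ x : Gm, (x⁻¹).u = -x.u := fun x => rfl
  let f : Quot (twistedConj (φ : Gm →* Gm)) → ℤ := Quot.lift (fun x => x.u) (by
    rintro x y ⟨k, rfl⟩
    simp [hmul, hinv, hu])
  have hf : Function.Surjective f := fun n => ⟨Quot.mk _ ⟨n, 0, 0, false⟩, rfl⟩
  have : Infinite (Quot (twistedConj (φ : Gm →* Gm))) := Infinite.of_surjective f hf
  exact ENat.card_eq_top_of_infinite

lemma form_det (φ : Gm ≃* Gm) (ε m q r s d2 d3 : ℤ) (h : HasForm φ ε m q r s d2 d3) :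
    (ε = 1 ∨ ε = -1) ∧
    ((2 * m + ε) * s - 2 * q * r = 1 ∨ (2 * m + ε) * s - 2 * q * r = -1) := by
  obtain ⟨ε', m', q', r', s', d2', d3', h'⟩ := aut_form φ.symm
  have k1 := φ.apply_symm_apply ⟨1, 0, 0, false⟩
  have k2 := φ.apply_symm_apply ⟨0, 1, 0, false⟩
  have k3 := φ.apply_symm_apply ⟨0, 0, 1, false⟩
  rw [(h' _ _ _).1, (h _ _ _).1, Gm.mk.injEq] at k1 k2 k3
  obtain ⟨a1, -, -, -⟩ := k1
  obtain ⟨-, b2, b3, -⟩ := k2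
  obtain ⟨-, c2, c3, -⟩ := k3
  simp only [mul_zero, mul_one, zero_add, add_zero] at a1 b2 b3 c2 c3
  constructor
  · exact Int.eq_one_or_neg_one_of_mul_eq_one a1
  · apply Int.eq_one_or_neg_one_of_mul_eq_one
      (v := (2 * m' + ε') * s' - 2 * q' * r')
    linear_combination (2 * q * r' + s * s') * b2 + c3
      - ((2 * m + ε) * r' + r * s') * b3

section count

variable (φ : Gm ≃* Gm) (m q r s d2 d3 : ℤ)

lemma tc_ff (h : HasForm φ (-1) m q r s d2 d3) (a b c a' b' c' : ℤ) :
    twistedConj (φ : Gm →* Gm) ⟨a, b, c, false⟩ ⟨a', b', c', false⟩ ↔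
      cmk m q r s a b c = cmk m q r s a' b' c' ∨
      cmk m q r s a b c = tau m q r s (-d2) (-d3) (cmk m q r s a' b' c') := by
  rw [tau_cmk, cmk_eq, cmk_eq]
  constructor
  · rintro ⟨⟨u, v, w, e⟩, hh⟩
    cases e
    · left
      rw [MonoidHom.coe_coe, (h _ _ _).1] at hh
      simp [Gm.mul_mk, Gm.inv_mk] at hh
      obtain ⟨h0, h1, h2⟩ := hh
      refine ⟨u, v, w, ?_, ?_, ?_⟩
      · rw [h0]; ring
      · rw [h1]; ring
      · rw [h2]; ring
    · right
      rw [MonoidHom.coe_coe, (h _ _ _).2] at hh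
      simp [Gm.mul_mk, Gm.inv_mk] at hh
      obtain ⟨h0, h1, h2⟩ := hh
      refine ⟨u, v, w, ?_, ?_, ?_⟩
      · rw [h0]; ring
      · rw [h1]; ring
      · rw [h2]; ring
  · rintro (⟨u, v, w, rfl, rfl, rfl⟩ | ⟨u, v, w, rfl, rfl, rfl⟩)
    · refine ⟨⟨u, v, w, false⟩, ?_⟩
      rw [MonoidHom.coe_coe, (h _ _ _).1]
      simp [Gm.mul_mk, Gm.inv_mk]
      refine ⟨?_, ?_, ?_⟩ <;> ring
    · refine ⟨⟨u, v, w, true⟩, ?_⟩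
      rw [MonoidHom.coe_coe, (h _ _ _).2]
      simp [Gm.mul_mk, Gm.inv_mk]
      refine ⟨?_, ?_, ?_⟩ <;> ring

lemma tc_tt (h : HasForm φ (-1) m q r s d2 d3) (a b c a' b' c' : ℤ) :
    twistedConj (φ : Gm →* Gm) ⟨a, b, c, true⟩ ⟨a', b', c', true⟩ ↔
      cmk (1 - m) (-q) (-r) (-s) a b c = cmk (1 - m) (-q) (-r) (-s) a' b' c' ∨
      cmk (1 - m) (-q) (-r) (-s) a b c =
        tau (1 - m) (-q) (-r) (-s) d2 d3 (cmk (1 - m) (-q) (-r) (-s) a' b' c') := by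
  rw [tau_cmk, cmk_eq, cmk_eq]
  constructor
  · rintro ⟨⟨u, v, w, e⟩, hh⟩
    cases e
    · left
      rw [MonoidHom.coe_coe, (h _ _ _).1] at hh
      simp [Gm.mul_mk, Gm.inv_mk] at hh
      obtain ⟨h0, h1, h2⟩ := hh
      refine ⟨u, v, w, ?_, ?_, ?_⟩
      · rw [h0]; ring
      · rw [h1]; ring
      · rw [h2]; ring
    · right
      rw [MonoidHom.coe_coe, (h _ _ _).2] at hh
      simp [Gm.mul_mk, Gm.inv_mk] at hh
      obtain ⟨h0, h1, h2⟩ := hh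
      refine ⟨u, v, w, ?_, ?_, ?_⟩
      · rw [h0]; ring
      · rw [h1]; ring
      · rw [h2]; ring
  · rintro (⟨u, v, w, rfl, rfl, rfl⟩ | ⟨u, v, w, rfl, rfl, rfl⟩)
    · refine ⟨⟨u, v, w, false⟩, ?_⟩
      rw [MonoidHom.coe_coe, (h _ _ _).1]
      simp [Gm.mul_mk, Gm.inv_mk]
      refine ⟨?_, ?_, ?_⟩ <;> ring
    · refine ⟨⟨u, v, w, true⟩, ?_⟩
      rw [MonoidHom.coe_coe, (h _ _ _).2]
      simp [Gm.mul_mk, Gm.inv_mk]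
      refine ⟨?_, ?_, ?_⟩ <;> ring

lemma tc_e (x y : Gm) (h : twistedConj (φ : Gm →* Gm) x y) : x.e = y.e := by
  obtain ⟨k, rfl⟩ := h
  have hmul : ∀ x y : Gm, (x * y).e = xor x.e y.e := fun x y => rfl
  have hinv : ∀ x : Gm, (x⁻¹).e = x.e := fun x => rfl
  rw [hmul, hmul, hinv, MonoidHom.coe_coe, aut_e]
  cases k.e <;> cases y.e <;> rfl

lemma exists_cover (h : HasForm φ (-1) m q r s d2 d3) :
    ∃ f : Cq m q r s ⊕ Cq (1 - m) (-q) (-r) (-s) → Quot (twistedConj (φ : Gm →* Gm)),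
      Function.Surjective f ∧ ∀ x y, f x = f y ↔ y = x ∨
        y = Sum.map (tau m q r s (-d2) (-d3)) (tau (1 - m) (-q) (-r) (-s) d2 d3) x := by
  choose A B C hABC using cmk_surj m q r s
  choose A' B' C' hABC' using cmk_surj (1 - m) (-q) (-r) (-s)
  refine ⟨Sum.elim (fun x => Quot.mk _ ⟨A x, B x, C x, false⟩)
    (fun x => Quot.mk _ ⟨A' x, B' x, C' x, true⟩), ?_, ?_⟩
  · rintro ⟨⟨a, b, c, e⟩⟩
    cases e
    · refine ⟨Sum.inl (cmk _ _ _ _ a b c), ?_⟩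
      rw [Sum.elim_inl, mk_eq_iff, tc_ff φ m q r s d2 d3 h, ← hABC]
      exact Or.inl rfl
    · refine ⟨Sum.inr (cmk _ _ _ _ a b c), ?_⟩
      rw [Sum.elim_inr, mk_eq_iff, tc_tt φ m q r s d2 d3 h, ← hABC']
      exact Or.inl rfl
  · rintro (x | x) (y | y)
    · rw [Sum.elim_inl, Sum.elim_inl, eq_comm, mk_eq_iff, tc_ff φ m q r s d2 d3 h, ← hABC,
        ← hABC]
      simp
    · rw [Sum.elim_inl, Sum.elim_inr, mk_eq_iff]
      simp only [Sum.map_inl, reduceCtorEq, or_self, iff_false]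
      intro hh
      simpa using tc_e φ _ _ hh
    · rw [Sum.elim_inl, Sum.elim_inr, mk_eq_iff]
      simp only [Sum.map_inr, reduceCtorEq, or_self, iff_false]
      intro hh
      simpa using tc_e φ _ _ hh
    · rw [Sum.elim_inr, Sum.elim_inr, eq_comm, mk_eq_iff, tc_tt φ m q r s d2 d3 h, ← hABC',
        ← hABC']
      simp

lemma form_count_top (h : HasForm φ (-1) m q r s d2 d3)
    (hd : (Bm m q r s).det = 0 ∨ (Bm (1 - m) (-q) (-r) (-s)).det = 0) :
    reidemeisterNumber (φ : Gm →* Gm) = ⊤ := by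
  obtain ⟨f, hf, hfx⟩ := exists_cover φ m q r s d2 d3 h
  by_contra hne
  have hfin : Finite (Quot (twistedConj (φ : Gm →* Gm))) := by
    by_contra hinf
    rw [not_finite_iff_infinite] at hinf
    exact hne ENat.card_eq_top_of_infinite
  have hX := finite_of_involution _ f hfx
  have h1 : Finite (Cq m q r s) := Finite.sum_left (Cq (1 - m) (-q) (-r) (-s))
  have h2 : Finite (Cq (1 - m) (-q) (-r) (-s)) := Finite.sum_right (Cq m q r s)
  rcases hd with hd | hd
  · exact (infinite_quot_range _ hd).not_finite h1
  · exact (infinite_quot_range _ hd).not_finite h2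

lemma form_count (h : HasForm φ (-1) m q r s d2 d3) (hs : Odd s)
    (hd1 : (Bm m q r s).det ≠ 0) (hd2 : (Bm (1 - m) (-q) (-r) (-s)).det ≠ 0) :
    ∃ n : ℕ, reidemeisterNumber (φ : Gm →* Gm) = n ∧
      2 * n = (Bm m q r s).det.natAbs + (Bm (1 - m) (-q) (-r) (-s)).det.natAbs
        + (if Even d3 then 8 else 0) := by
  obtain ⟨f, hf, hfx⟩ := exists_cover φ m q r s d2 d3 h
  have c1 : Nat.card (Cq m q r s) = _ := card_quot_range _ hd1
  have c2 : Nat.card (Cq (1 - m) (-q) (-r) (-s)) = _ := card_quot_range _ hd2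
  have f1 : Finite (Cq m q r s) := Nat.finite_of_card_ne_zero (by rw [c1]; simpa using hd1)
  have f2 : Finite (Cq (1 - m) (-q) (-r) (-s)) :=
    Nat.finite_of_card_ne_zero (by rw [c2]; simpa using hd2)
  have hfin : Finite (Quot (twistedConj (φ : Gm →* Gm))) := Finite.of_surjective f hf
  refine ⟨Nat.card (Quot (twistedConj (φ : Gm →* Gm))), ENat.card_eq_coe_natCard _, ?_⟩
  rw [involution_count _ f hf hfx, Nat.card_sum, c1, c2]
  congr 1
  have e := Nat.card_congr (Equiv.subtypeSum (α := Cq m q r s)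
    (β := Cq (1 - m) (-q) (-r) (-s)) (p := fun x =>
    Sum.map (tau m q r s (-d2) (-d3)) (tau (1 - m) (-q) (-r) (-s) d2 d3) x = x))
  rw [e, Nat.card_sum]
  simp only [Sum.map_inl, Sum.map_inr, Sum.inl.injEq, Sum.inr.injEq]
  rw [card_fix _ _ _ _ _ _ hs, card_fix _ _ _ _ _ _ hs.neg]
  simp only [even_neg]
  split_ifs <;> rfl

end count

/-- The automorphism with Reidemeister number `4 k`. -/
def autK (k : ℤ) : Gm ≃* Gm where
  toFun x := ⟨-x.u, k * x.u + (2 * k - 1) * x.a + x.b,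
    k * x.u + 2 * k * x.a + x.b + (if x.e then 1 else 0), x.e⟩
  invFun x := ⟨-x.u, -x.a + x.b - (if x.e then 1 else 0),
    2 * k * x.a + (1 - 2 * k) * (x.b - (if x.e then 1 else 0)) + k * x.u, x.e⟩
  left_inv x := by
    obtain ⟨u, a, b, e⟩ := x
    ext
    · simp
    · simp; ring
    · simp; ring
    · rfl
  right_inv x := by
    obtain ⟨u, a, b, e⟩ := x
    ext
    · simp
    · simp; ring
    · simp; ring
    · rfl
  map_mul' x y := by
    obtain ⟨u, a, b, e⟩ := x
    obtain ⟨u', a', b', e'⟩ := y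
    cases e <;> cases e' <;> simp [Gm.mul_mk] <;> refine ⟨?_, ?_, ?_⟩ <;> ring

lemma autK_form (k : ℤ) : HasForm (autK k) (-1) k k 1 1 0 1 := by
  intro u a b
  constructor
  · change (⟨_, _, _, _⟩ : Gm) = _
    simp [sub_eq_add_neg]
  · change (⟨_, _, _, _⟩ : Gm) = _
    simp [sub_eq_add_neg]

lemma spectrum_Gm : reidemeisterSpectrum Gm =
    {r : ℕ∞ | ∃ k : ℕ, 0 < k ∧ r = 4 * (k : ℕ∞)} ∪ {⊤} := by
  ext R
  constructor
  · rintro ⟨φ, rfl⟩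
    obtain ⟨ε, m, q, r, s, d2, d3, h⟩ := aut_form φ
    obtain ⟨hε, hδ⟩ := form_det φ ε m q r s d2 d3 h
    rcases hε with rfl | rfl
    · right
      exact form_top φ m q r s d2 d3 h
    by_cases hd : (Bm m q r s).det = 0 ∨ (Bm (1 - m) (-q) (-r) (-s)).det = 0
    · right
      exact form_count_top φ m q r s d2 d3 h hd
    push Not at hd
    have hs : Odd s := by
      have : Odd ((2 * m + -1) * s - 2 * q * r) := by
        rcases hδ with h | h <;> rw [h] <;> decide
      have h2 : Odd ((2 * m + -1) * s) := by
        have e : (2 * m + -1) * s = ((2 * m + -1) * s - 2 * q * r) + 2 * (q * r) := by ring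
        rw [e]
        exact this.add_even (even_two_mul _)
      exact (Int.odd_mul.1 h2).2
    left
    obtain ⟨n, hn, hn2⟩ := form_count φ m q r s d2 d3 h hs hd.1 hd.2
    obtain ⟨δ, hδe⟩ : ∃ δ, δ = (2 * m + -1) * s - 2 * q * r := ⟨_, rfl⟩
    have D1 : (Bm m q r s).det = 2 * (1 + δ - (2 * m - 1 + s)) := by
      rw [det_Bm, hδe]; ring
    have D2 : (Bm (1 - m) (-q) (-r) (-s)).det = 2 * (1 + δ + (2 * m - 1 + s)) := by
      rw [det_Bm, hδe]; ring
    rw [D1, D2] at hn2 hd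
    rw [← hδe] at hδ
    obtain ⟨t, rfl⟩ := hs
    have h4 : ∃ k, 0 < k ∧ n = 4 * k := by
      refine ⟨n / 4, ?_⟩
      obtain ⟨hd1, hd2⟩ := hd
      clear hδe D1 D2 hn h
      split_ifs at hn2 <;> rcases hδ with rfl | rfl <;> omega
    obtain ⟨k, hk, rfl⟩ := h4
    exact ⟨k, hk, by rw [hn]; push_cast; rfl⟩
  · rintro (⟨k, hk, rfl⟩ | hR)
    · refine ⟨autK k, ?_⟩
      have D1 : (Bm k k 1 1).det = -4 * k := by rw [det_Bm]; ring
      have D2 : (Bm (1 - k) (-k) (-1) (-1)).det = 4 * k := by rw [det_Bm]; ring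
      obtain ⟨n, hn, hn2⟩ := form_count (autK k) k k 1 1 0 1 (autK_form k) (by decide)
        (by rw [D1]; omega) (by rw [D2]; omega)
      rw [D1, D2, if_neg (by decide)] at hn2
      have : n = 4 * k := by omega
      rw [hn, this]; push_cast; rfl
    · rw [Set.mem_singleton_iff] at hR
      subst hR
      refine ⟨MulEquiv.refl _, form_top _ 0 0 0 1 0 0 ?_⟩
      intro u a b
      simp

/-- The Reidemeister spectrum of the crystallographic group `Γ = 3/2/1/2/1` is
`4ℕ ∪ {∞}`: the positive multiples of `4` together with `∞`. -/
theorem stmt18 :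
    reidemeisterSpectrum ↥Gamma3 =
      {r : ℕ∞ | ∃ k : ℕ, 0 < k ∧ r = 4 * (k : ℕ∞)} ∪ {⊤} := by
  rw [← reidemeisterSpectrum_congr Gm.equivGamma]
  exact spectrum_Gm
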